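/- arXiv:2605.24741 — 2 statements merged into one kernel-verified Lean document; each statement's English description precedes it below -/
import Mathlib

section
/- There exists a universal constant C > 0 such that for every nonempty finite set X, all distributions p, q on X, and every ε with 0 < ε ≤ d_TV(p,q)/4: n*_Sub(p,q,ε) ≤ C·n*_Hub(p,q,ε). Moreover, for every δ₀ > 0 there exist constants C'(δ₀) > 0 and ε̄(δ₀) > 0 such that for all such p, q and every ε with 0 < ε ≤ min(d_TV(p,q)/4, ε̄(δ₀)) and (1+δ₀)ε < 1: n*_Hub(p,q,ε) ≤ C'(δ₀)·n*_Sub(p,q,(1+δ₀)ε). -/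
open scoped Classical ENNReal
open Finset

noncomputable section

/-- A probability distribution on a finite set. -/
def IsDist {X : Type*} [Fintype X] (p : X → ℝ) : Prop :=
  (∀ x, 0 ≤ p x) ∧ ∑ x, p x = 1

/-- Total variation distance. -/
def dTV {X : Type*} [Fintype X] (p q : X → ℝ) : ℝ :=
  (1 / 2) * ∑ x, |p x - q x|

/-- Squared Hellinger divergence (also for unnormalized nonnegative vectors). -/
def hellSq {X : Type*} [Fintype X] (p q : X → ℝ) : ℝ :=
  ∑ x, (Real.sqrt (p x) - Real.sqrt (q x)) ^ 2

/-- ε-Huber uncertainty set. -/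
def PHub {X : Type*} [Fintype X] (p : X → ℝ) (ε : ℝ) : Set (X → ℝ) :=
  {p' | IsDist p' ∧ ∀ x, (1 - ε) * p x ≤ p' x}

/-- ε-TV uncertainty set. -/
def PTV {X : Type*} [Fintype X] (p : X → ℝ) (ε : ℝ) : Set (X → ℝ) :=
  {p' | IsDist p' ∧ dTV p' p ≤ ε}

/-- ε-subtractive uncertainty set. -/
def PSub {X : Type*} [Fintype X] (p : X → ℝ) (ε : ℝ) : Set (X → ℝ) :=
  {p' | IsDist p' ∧ ∀ x, p' x ≤ (1 + ε) * p x}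

/-- Sum of worst-case type-I and type-II errors of a randomized test `φ` on `n`
i.i.d. samples, for composite hypotheses `Pcal` vs `Qcal`. -/
def errSum {X : Type*} [Fintype X] (Pcal Qcal : Set (X → ℝ)) (n : ℕ)
    (φ : (Fin n → X) → ℝ) : ℝ :=
  (⨆ P : Pcal, ∑ x : Fin n → X, (∏ i, (P : X → ℝ) (x i)) * φ x) +
  (⨆ Q : Qcal, ∑ x : Fin n → X, (∏ i, (Q : X → ℝ) (x i)) * (1 - φ x))

/-- Minimax `n`-sample error for testing `Pcal` against `Qcal`. -/
def eStar {X : Type*} [Fintype X] (Pcal Qcal : Set (X → ℝ)) (n : ℕ) : ℝ :=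
  ⨅ φ : {φ : (Fin n → X) → ℝ // ∀ x, 0 ≤ φ x ∧ φ x ≤ 1}, errSum Pcal Qcal n φ.1

/-- Sample complexity: the least `n` with minimax error at most `1/10` (`⊤` if none). -/
def nStar {X : Type*} [Fintype X] (Pcal Qcal : Set (X → ℝ)) : ℝ≥0∞ :=
  sInf {N : ℝ≥0∞ | ∃ n : ℕ, N = (n : ℝ≥0∞) ∧ eStar Pcal Qcal n ≤ 1 / 10}

lemma sqrt_sub_sqrt_sq_mul_add_le {u v : ℝ} (hu : 0 ≤ u) (hv : 0 ≤ v) :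
    (√u - √v) ^ 2 * (u + v) ≤ (u - v) ^ 2 := by
  obtain ⟨a, ha, rfl⟩ : ∃ a : ℝ, 0 ≤ a ∧ a ^ 2 = u := ⟨√u, Real.sqrt_nonneg u, Real.sq_sqrt hu⟩
  obtain ⟨b, hb, rfl⟩ : ∃ b : ℝ, 0 ≤ b ∧ b ^ 2 = v := ⟨√v, Real.sqrt_nonneg v, Real.sq_sqrt hv⟩
  rw [Real.sqrt_sq ha, Real.sqrt_sq hb]
  nlinarith [mul_nonneg (mul_nonneg ha hb) (sq_nonneg (a - b))]

lemma sub_sq_le_sqrt_sub_sqrt_sq {u v : ℝ} (hu : 0 ≤ u) (hv : 0 ≤ v) :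
    (u - v) ^ 2 ≤ 2 * (u + v) * (√u - √v) ^ 2 := by
  obtain ⟨a, ha, rfl⟩ : ∃ a : ℝ, 0 ≤ a ∧ a ^ 2 = u := ⟨√u, Real.sqrt_nonneg u, Real.sq_sqrt hu⟩
  obtain ⟨b, hb, rfl⟩ : ∃ b : ℝ, 0 ≤ b ∧ b ^ 2 = v := ⟨√v, Real.sqrt_nonneg v, Real.sq_sqrt hv⟩
  rw [Real.sqrt_sq ha, Real.sqrt_sq hb]
  nlinarith [mul_nonneg (sq_nonneg (a - b)) (sq_nonneg (a - b))]

lemma sqrt_sub_sqrt_sq_le_of_sub_eq {u v u' v' κ : ℝ} (hu : 0 ≤ u) (hv : 0 ≤ v) (hu' : 0 ≤ u')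
    (hv' : 0 ≤ v') (hκ : 0 < κ) (hκ1 : κ ≤ 1) (hsub : u' - v' = κ * (u - v))
    (hadd : κ * (u + v) ≤ u' + v') :
    (√u' - √v') ^ 2 ≤ 2 * (√u - √v) ^ 2 := by
  rcases (add_nonneg hu hv).eq_or_lt with h | h
  · have h1 : u = v := by linarith
    have h2 : u' = v' := by rw [h1] at hsub; linarith
    simp [h1, h2]
  · have h1 := sqrt_sub_sqrt_sq_mul_add_le hu' hv'
    have h2 := sub_sq_le_sqrt_sub_sqrt_sq hu hv
    rw [hsub] at h1
    refine le_of_mul_le_mul_right ?_ (mul_pos hκ h)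
    calc (√u' - √v') ^ 2 * (κ * (u + v)) ≤ (√u' - √v') ^ 2 * (u' + v') := by gcongr
      _ ≤ κ * (κ * (u - v) ^ 2) := by linarith
      _ ≤ κ * (1 * (2 * (u + v) * (√u - √v) ^ 2)) := by gcongr
      _ = _ := by ring

/-- Moving the smaller argument up and the larger one down, without crossing, decreases
`(√u - √v) ^ 2`. -/
lemma sqrt_sub_sqrt_sq_mono {u v u' v' : ℝ} (hv : v ≤ v') (hvu : v' ≤ u') (hu : u' ≤ u) :
    (√u' - √v') ^ 2 ≤ (√u - √v) ^ 2 := by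
  have h1 := Real.sqrt_le_sqrt hv
  have h2 := Real.sqrt_le_sqrt hvu
  have h3 := Real.sqrt_le_sqrt hu
  apply pow_le_pow_left₀ <;> linarith

lemma sqrt_sub_sqrt_sq_le_transfer {a b β d : ℝ} (hb : 0 ≤ b) (hβ : 0 ≤ β) (hd : 0 < d)
    (h : b + (1 + d) * β ≤ a) :
    (√(a - (1 + d) * β) - √b) ^ 2 ≤ 4 * (1 + d) / d * (√a - √(b + β)) ^ 2 := by
  have hdβ : 0 ≤ d * β := by positivity
  have ha : 0 ≤ a := by nlinarith
  rcases ha.eq_or_lt with h0 | h0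
  · have : b = 0 := by nlinarith
    have : β = 0 := by nlinarith
    subst_vars
    simp
  have h1 := sqrt_sub_sqrt_sq_mul_add_le (u := a - β) (v := b) (by nlinarith) hb
  have h2 := sub_sq_le_sqrt_sub_sqrt_sq (u := a) (v := b + β) ha (by positivity)
  have h3 : (√(a - (1 + d) * β) - √b) ^ 2 ≤ (√(a - β) - √b) ^ 2 :=
    sqrt_sub_sqrt_sq_mono le_rfl (by linarith) (by linarith)
  have h4 : d * a ≤ (1 + d) * (a - β + b) := by nlinarith
  refine h3.trans (le_of_mul_le_mul_right ?_ (mul_pos hd h0))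
  calc (√(a - β) - √b) ^ 2 * (d * a)
      ≤ (√(a - β) - √b) ^ 2 * ((1 + d) * (a - β + b)) := by gcongr
    _ = (1 + d) * ((√(a - β) - √b) ^ 2 * (a - β + b)) := by ring
    _ ≤ (1 + d) * (2 * (a + (b + β)) * (√a - √(b + β)) ^ 2) := by
        have h5 : (a - β - b) ^ 2 = (a - (b + β)) ^ 2 := by ring
        exact mul_le_mul_of_nonneg_left (by linarith) (by linarith)
    _ ≤ (1 + d) * (2 * (2 * a) * (√a - √(b + β)) ^ 2) := by
        gcongr
        linarith
    _ = _ := by field_simp; ring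

section Dist

variable {X : Type*} [Fintype X] {p q P Q : X → ℝ} {ε : ℝ}

lemma dTV_eq_sum_max (hp : IsDist p) (hq : IsDist q) :
    dTV p q = ∑ x, max (p x - q x) 0 := by
  have h : ∀ x, |p x - q x| = 2 * max (p x - q x) 0 - (p x - q x) := fun x ↦ by
    rcases le_total (p x - q x) 0 with h | h
    · rw [abs_of_nonpos h, max_eq_right h]; ring
    · rw [abs_of_nonneg h, max_eq_left h]; ring
  simp only [dTV, h, Finset.sum_sub_distrib, ← Finset.mul_sum, hp.2, hq.2]
  ring

lemma dTV_comm (p q : X → ℝ) : dTV p q = dTV q p := by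
  simp only [dTV, abs_sub_comm]

lemma dTV_le_one (hp : IsDist p) (hq : IsDist q) : dTV p q ≤ 1 := by
  rw [dTV_eq_sum_max hp hq, ← hp.2]
  exact Finset.sum_le_sum fun x _ ↦ max_le (by linarith [hq.1 x]) (hp.1 x)

lemma hellSq_eq (hp : IsDist p) (hq : IsDist q) :
    hellSq p q = 2 * (1 - ∑ x, √(p x * q x)) := by
  have h : ∀ x, (√(p x) - √(q x)) ^ 2 = p x + q x - 2 * √(p x * q x) := fun x ↦ by
    rw [sub_sq, Real.sq_sqrt (hp.1 x), Real.sq_sqrt (hq.1 x), Real.sqrt_mul (hp.1 x)]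
    ring
  simp only [hellSq, h, Finset.sum_sub_distrib, Finset.sum_add_distrib, ← Finset.mul_sum,
    hp.2, hq.2]
  ring

lemma PSub_mono (hp : IsDist p) {ε' : ℝ} (h : ε ≤ ε') : PSub p ε ⊆ PSub p ε' := fun P hP ↦
  ⟨hP.1, fun x ↦ (hP.2 x).trans (mul_le_mul_of_nonneg_right (by linarith) (hp.1 x))⟩

/-- Every pair of subtractive contaminations is matched by a pair of Huber contaminations at
comparable Hellinger divergence. -/
lemma exists_PHub_hellSq_le (hp : IsDist p) (hq : IsDist q) (h0 : 0 ≤ ε) (h1 : ε < 1)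
    (hP : P ∈ PSub p ε) (hQ : Q ∈ PSub q ε) :
    ∃ P' ∈ PHub p ε, ∃ Q' ∈ PHub q ε, hellSq P' Q' ≤ 2 * hellSq P Q := by
  obtain ⟨hP, hPp⟩ := hP
  obtain ⟨hQ, hQq⟩ := hQ
  set κ := (1 - ε) / (1 + ε)
  have hκ0 : 0 < κ := div_pos (by linarith) (by linarith)
  have hκ1 : κ ≤ 1 := (div_le_one (by linarith)).2 (by linarith)
  have hκm : κ * (1 + ε) = 1 - ε := div_mul_cancel₀ _ (by linarith)
  have hw : 0 ≤ ε * (1 - κ) := mul_nonneg h0 (by linarith)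
  have mem : ∀ {r s S : X → ℝ}, IsDist r → IsDist s → IsDist S → (∀ x, S x ≤ (1 + ε) * s x) →
      (fun x ↦ (1 - ε) * r x + κ * ((1 + ε) * s x - S x) + ε * (1 - κ) * p x) ∈ PHub r ε := by
    intro r s S hr hs hS hSs
    have hle : ∀ x, (1 - ε) * r x ≤
        (1 - ε) * r x + κ * ((1 + ε) * s x - S x) + ε * (1 - κ) * p x := fun x ↦ by
      have := mul_nonneg hκ0.le (sub_nonneg.2 (hSs x))
      have := mul_nonneg hw (hp.1 x)
      linarith
    refine ⟨⟨fun x ↦ (mul_nonneg (by linarith) (hr.1 x)).trans (hle x), ?_⟩, hle⟩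
    simp only [Finset.sum_add_distrib, Finset.sum_sub_distrib, ← Finset.mul_sum,
      hr.2, hs.2, hS.2, hp.2]
    linarith
  have hP' := mem hp hq hQ hQq
  have hQ' := mem hq hp hP hPp
  refine ⟨_, hP', _, hQ', ?_⟩
  simp only [hellSq, Finset.mul_sum]
  refine Finset.sum_le_sum fun x _ ↦ ?_
  refine sqrt_sub_sqrt_sq_le_of_sub_eq (hP.1 x) (hQ.1 x) (hP'.1.1 x) (hQ'.1.1 x) hκ0 hκ1 ?_ ?_
  · linear_combination (q x - p x) * hκm
  · have h2 := mul_nonneg hκ0.le (sub_nonneg.2 (hPp x))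
    have h3 := mul_nonneg hκ0.le (sub_nonneg.2 (hQq x))
    have h4 := mul_nonneg hw (hp.1 x)
    have h5 : κ * (1 + ε) * (p x + q x) = (1 - ε) * (p x + q x) := by rw [hκm]
    linarith

/-- Removing mass `e` from `(1 + e) • p` where `p` exceeds `q`, at least `1 + δ` times the mass
that a Huber contamination `Q` adds to `q` there. -/
lemma exists_PSub_between (hp : IsDist p) (hq : IsDist q) {δ : ℝ} (h0 : 0 ≤ ε) (hδ0 : 0 ≤ δ)
    (hδ1 : δ ≤ 1) (hε : ε ≤ dTV p q / 4) (hQ : Q ∈ PHub q ε) :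
    ∃ P' ∈ PSub p ((1 + δ) * ε), ∀ x,
      (p x ≤ q x → P' x = (1 + (1 + δ) * ε) * p x) ∧
      (q x ≤ p x → (1 + (1 + δ) * ε) * q x ≤ P' x ∧
        P' x ≤ max ((1 + (1 + δ) * ε) * q x)
          ((1 + (1 + δ) * ε) * p x - (1 + δ) * (min (Q x) ((1 - ε) * p x) - (1 - ε) * q x))) := by
  obtain ⟨hQ, hQq⟩ := hQ
  have hε1 : ε ≤ 1 := by linarith [dTV_le_one hp hq]
  set e := (1 + δ) * ε with he
  have he0 : 0 ≤ e := by positivity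
  set U : X → ℝ := fun x ↦ (1 + e) * max (p x - q x) 0 with hU
  set L : X → ℝ := fun x ↦
    min ((1 + δ) * (min (Q x) ((1 - ε) * max (p x) (q x)) - (1 - ε) * q x)) (U x) with hL
  have hU0 : ∀ x, 0 ≤ U x := fun x ↦ by positivity
  have hL0 : ∀ x, 0 ≤ L x := fun x ↦ by
    refine le_min (mul_nonneg (by linarith) (sub_nonneg.2 (le_min (hQq x) ?_))) (hU0 x)
    exact mul_le_mul_of_nonneg_left (le_max_right _ _) (by linarith)
  have hLU : ∀ x, L x ≤ U x := fun x ↦ min_le_right _ _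
  have hLsum : ∑ x, L x ≤ e := by
    calc ∑ x, L x ≤ ∑ x, (1 + δ) * (Q x - (1 - ε) * q x) := by
          refine Finset.sum_le_sum fun x _ ↦ (min_le_left _ _).trans ?_
          have := min_le_left (Q x) ((1 - ε) * max (p x) (q x))
          gcongr
      _ = e := by
          rw [← Finset.mul_sum, Finset.sum_sub_distrib, ← Finset.mul_sum, hQ.2, hq.2, he]
          ring
  have hUsum : e ≤ ∑ x, U x := by
    rw [hU, ← Finset.mul_sum, ← dTV_eq_sum_max hp hq]
    nlinarith
  obtain ⟨R, hLR, hRU, hR⟩ : ∃ R : X → ℝ, (∀ x, L x ≤ R x) ∧ (∀ x, R x ≤ U x) ∧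
      ∑ x, R x = e := by
    rcases (hLsum.trans hUsum).eq_or_lt with h | h
    · exact ⟨L, fun x ↦ le_rfl, hLU, by linarith⟩
    · have hpos : 0 < ∑ x, U x - ∑ x, L x := by linarith
      set θ := (e - ∑ x, L x) / (∑ x, U x - ∑ x, L x) with hθ
      have hθ0 : 0 ≤ θ := div_nonneg (by linarith) hpos.le
      have hθ1 : θ ≤ 1 := (div_le_one hpos).2 (by linarith)
      refine ⟨fun x ↦ L x + θ * (U x - L x), fun x ↦ ?_, fun x ↦ ?_, ?_⟩
      · nlinarith [mul_nonneg hθ0 (sub_nonneg.2 (hLU x))]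
      · nlinarith [mul_nonneg (sub_nonneg.2 hθ1) (sub_nonneg.2 (hLU x))]
      · rw [Finset.sum_add_distrib, ← Finset.mul_sum, Finset.sum_sub_distrib, hθ,
          div_mul_cancel₀ _ hpos.ne']
        ring
  have hUle : ∀ x, q x ≤ p x → U x = (1 + e) * p x - (1 + e) * q x := fun x hx ↦ by
    simp only [hU]
    rw [max_eq_left (by linarith)]
    ring
  have hR0 : ∀ x, p x ≤ q x → R x = 0 := fun x hx ↦ by
    have : U x = 0 := by
      simp only [hU]
      rw [max_eq_right (by linarith), mul_zero]
    linarith [hL0 x, hLR x, hRU x]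
  refine ⟨fun x ↦ (1 + e) * p x - R x, ⟨⟨fun x ↦ ?_, ?_⟩, fun x ↦ ?_⟩, fun x ↦ ⟨fun hx ↦ ?_,
    fun hx ↦ ⟨?_, ?_⟩⟩⟩
  · rcases le_total (p x) (q x) with hx | hx
    · have := hR0 x hx
      have := mul_nonneg (by linarith : 0 ≤ 1 + e) (hp.1 x)
      linarith
    · have := hUle x hx
      have := mul_nonneg (by linarith : 0 ≤ 1 + e) (hq.1 x)
      linarith [hRU x]
  · rw [Finset.sum_sub_distrib, ← Finset.mul_sum, hp.2, hR]
    ring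
  · linarith [hL0 x, hLR x]
  · simp only [hR0 x hx, sub_zero]
  · linarith [hUle x hx, hRU x]
  · have h2 := hLR x
    simp only [hL, max_eq_left hx] at h2
    rcases min_le_iff.1 h2 with h | h
    · exact le_max_of_le_right (by linarith)
    · exact le_max_of_le_left (by linarith [hUle x hx])

lemma sqrt_sub_sqrt_sq_le_of_between {a b A B A' δ : ℝ} (hb : 0 ≤ b) (hba : b ≤ a)
    (h0 : 0 ≤ ε) (hδ0 : 0 < δ) (hδ1 : δ ≤ 1) (hε : ε ≤ δ / 10) (hA : (1 - ε) * a ≤ A)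
    (hB : (1 - ε) * b ≤ B) (hbA : (1 + (1 + δ) * ε) * b ≤ A')
    (hA' : A' ≤ max ((1 + (1 + δ) * ε) * b)
      ((1 + (1 + δ) * ε) * a - (1 + δ) * (min B ((1 - ε) * a) - (1 - ε) * b))) :
    (√A' - √((1 + (1 + δ) * ε) * b)) ^ 2 ≤ 32 / δ * (√A - √B) ^ 2 := by
  have hδε : δ * ε ≤ ε := by nlinarith
  have hδε0 : 0 ≤ δ * ε := by positivity
  set e := (1 + δ) * ε with he
  have he0 : 0 ≤ e := by positivity
  rcases le_or_gt A' ((1 + e) * b) with hlt | hgt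
  · rw [le_antisymm hlt hbA, sub_self, sq, zero_mul]
    positivity
  have hA'' := (le_max_iff.1 hA').resolve_left hgt.not_ge
  set m := min B ((1 - ε) * a) with hm
  have hε1 : 0 < 1 - ε := by linarith
  have hbm : (1 - ε) * b ≤ m := le_min hB (mul_le_mul_of_nonneg_left hba hε1.le)
  set t := (1 + e) / (1 - ε) with ht
  have ht0 : 0 < t := by positivity
  have htm : t * (1 - ε) = 1 + e := div_mul_cancel₀ _ hε1.ne'
  have ht2 : t ≤ 2 := (div_le_iff₀ hε1).2 (by linarith)
  have htδ : (1 + δ / 2) * t ≤ 1 + δ := by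
    rw [ht, mul_div_assoc', div_le_iff₀ hε1, he]
    nlinarith [mul_nonneg hδε0 hδ0.le]
  set β := t * (m - (1 - ε) * b) with hβ
  have hβ0 : 0 ≤ β := mul_nonneg ht0.le (by linarith)
  have hle : A' ≤ (1 + e) * a - (1 + δ / 2) * β := by
    have := mul_le_mul_of_nonneg_right htδ (sub_nonneg.2 hbm)
    rw [hβ]
    linarith
  have key := sqrt_sub_sqrt_sq_le_transfer (a := (1 + e) * a) (b := (1 + e) * b) (d := δ / 2)
    (by positivity) hβ0 (by positivity) (by linarith)
  have e1 : (1 + e) * a = t * ((1 - ε) * a) := by rw [← htm]; ring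
  have e2 : (1 + e) * b + β = t * m := by rw [hβ, ← htm]; ring
  rw [e2, e1, Real.sqrt_mul ht0.le, Real.sqrt_mul ht0.le, ← mul_sub, mul_pow,
    Real.sq_sqrt ht0.le, ← e1] at key
  have hAB : (√((1 - ε) * a) - √m) ^ 2 ≤ (√A - √B) ^ 2 := by
    rcases le_total B ((1 - ε) * a) with h | h
    · rw [hm, min_eq_left h]
      exact sqrt_sub_sqrt_sq_mono le_rfl h hA
    · rw [hm, min_eq_right h, sub_self, sq, zero_mul]
      positivity
  calc (√A' - √((1 + e) * b)) ^ 2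
      ≤ (√((1 + e) * a - (1 + δ / 2) * β) - √((1 + e) * b)) ^ 2 :=
        sqrt_sub_sqrt_sq_mono le_rfl hbA hle
    _ ≤ 4 * (1 + δ / 2) / (δ / 2) * (t * (√((1 - ε) * a) - √m) ^ 2) := key
    _ ≤ 4 * (1 + 1) / (δ / 2) * (2 * (√A - √B) ^ 2) := by gcongr; linarith
    _ = _ := by field_simp; ring

/-- Every pair of Huber contaminations is matched by a pair of slightly larger subtractive
contaminations at comparable Hellinger divergence. -/
lemma exists_PSub_hellSq_le (hp : IsDist p) (hq : IsDist q) {δ : ℝ} (h0 : 0 ≤ ε) (hδ0 : 0 < δ)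
    (hδ1 : δ ≤ 1) (hε : ε ≤ dTV p q / 4) (hεδ : ε ≤ δ / 10)
    (hP : P ∈ PHub p ε) (hQ : Q ∈ PHub q ε) :
    ∃ P' ∈ PSub p ((1 + δ) * ε), ∃ Q' ∈ PSub q ((1 + δ) * ε),
      hellSq P' Q' ≤ 32 / δ * hellSq P Q := by
  obtain ⟨P', hP', hPP⟩ := exists_PSub_between hp hq h0 hδ0.le hδ1 hε hQ
  obtain ⟨Q', hQ', hQQ⟩ := exists_PSub_between hq hp h0 hδ0.le hδ1 (by rwa [dTV_comm]) hP
  refine ⟨P', hP', Q', hQ', ?_⟩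
  simp only [hellSq, Finset.mul_sum]
  refine Finset.sum_le_sum fun x _ ↦ ?_
  rcases le_total (q x) (p x) with h | h
  · rw [(hQQ x).1 h]
    obtain ⟨h1, h2⟩ := (hPP x).2 h
    exact sqrt_sub_sqrt_sq_le_of_between (hq.1 x) h h0 hδ0 hδ1 hεδ (hP.2 x) (hQ.2 x) h1 h2
  · rw [(hPP x).1 h, sub_sq_comm, sub_sq_comm (√(P x))]
    obtain ⟨h1, h2⟩ := (hQQ x).2 h
    exact sqrt_sub_sqrt_sq_le_of_between (hp.1 x) h h0 hδ0 hδ1 hεδ (hQ.2 x) (hP.2 x) h1 h2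

lemma isCompact_setOf_isDist_and {s : Set (X → ℝ)} (hs : IsClosed s) :
    IsCompact {P : X → ℝ | IsDist P ∧ P ∈ s} := by
  refine (isCompact_Icc (a := (0 : X → ℝ)) (b := 1)).of_isClosed_subset ?_ ?_
  · refine IsClosed.inter (IsClosed.inter ?_ ?_) hs
    · exact isClosed_Ici (a := (0 : X → ℝ))
    · exact isClosed_eq (by fun_prop) continuous_const
  · rintro P ⟨hP, -⟩
    refine ⟨hP.1, fun x ↦ ?_⟩
    rw [Pi.one_apply, ← hP.2]
    exact Finset.single_le_sum (fun y _ ↦ hP.1 y) (Finset.mem_univ x)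

lemma convex_setOf_isDist : Convex ℝ {P : X → ℝ | IsDist P} := by
  intro P hP Q hQ a b ha hb hab
  refine ⟨fun x ↦ add_nonneg (mul_nonneg ha (hP.1 x)) (mul_nonneg hb (hQ.1 x)), ?_⟩
  simp only [Pi.add_apply, Pi.smul_apply, smul_eq_mul, Finset.sum_add_distrib, ← Finset.mul_sum,
    hP.2, hQ.2]
  linarith

lemma isCompact_PHub : IsCompact (PHub p ε) :=
  isCompact_setOf_isDist_and (isClosed_Ici (a := (1 - ε) • p))

lemma isCompact_PSub : IsCompact (PSub p ε) :=
  isCompact_setOf_isDist_and (isClosed_Iic (a := (1 + ε) • p))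

lemma convex_PHub : Convex ℝ (PHub p ε) :=
  convex_setOf_isDist.inter (convex_Ici ((1 - ε) • p))

lemma convex_PSub : Convex ℝ (PSub p ε) :=
  convex_setOf_isDist.inter (convex_Iic ((1 + ε) • p))

lemma self_mem_PHub (hp : IsDist p) (h0 : 0 ≤ ε) : p ∈ PHub p ε :=
  ⟨hp, fun x ↦ by nlinarith [hp.1 x]⟩

lemma self_mem_PSub (hp : IsDist p) (h0 : 0 ≤ ε) : p ∈ PSub p ε :=
  ⟨hp, fun x ↦ by nlinarith [hp.1 x]⟩

end Dist

section Testing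

variable {X : Type*} [Fintype X] {𝒜 ℬ : Set (X → ℝ)} {n : ℕ}

lemma sum_prod_mul_prod (P g : X → ℝ) (n : ℕ) :
    ∑ x : Fin n → X, (∏ i, P (x i)) * ∏ i, g (x i) = (∑ x, P x * g x) ^ n := by
  simp only [← Finset.prod_mul_distrib, Fintype.sum_pow]

lemma IsDist.prod {P : X → ℝ} (hP : IsDist P) (n : ℕ) :
    IsDist fun x : Fin n → X ↦ ∏ i, P (x i) :=
  ⟨fun _ ↦ Finset.prod_nonneg fun _ _ ↦ hP.1 _, by rw [← Fintype.sum_pow, hP.2, one_pow]⟩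

/-- The Le Cam inequality: the squared affinity is at most twice the sum of the errors of a test. -/
lemma sq_sum_sqrt_mul_le {Y : Type*} [Fintype Y] {P Q φ : Y → ℝ} (hP : IsDist P)
    (hQ : IsDist Q) (hφ : ∀ y, 0 ≤ φ y ∧ φ y ≤ 1) :
    (∑ y, √(P y * Q y)) ^ 2 ≤ 2 * (∑ y, P y * φ y + ∑ y, Q y * (1 - φ y)) := by
  have h1 : (∑ y, √(P y * Q y)) ^ 2 ≤ (∑ y, min (P y) (Q y)) * ∑ y, max (P y) (Q y) := by
    refine Finset.sum_sq_le_sum_mul_sum_of_sq_le_mul _ (fun y _ ↦ le_min (hP.1 y) (hQ.1 y))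
      (fun y _ ↦ le_max_of_le_left (hP.1 y)) fun y _ ↦ ?_
    rw [Real.sq_sqrt (mul_nonneg (hP.1 y) (hQ.1 y)), min_mul_max]
  have h2 : ∑ y, max (P y) (Q y) ≤ 2 := by
    calc ∑ y, max (P y) (Q y) ≤ ∑ y, (P y + Q y) :=
          Finset.sum_le_sum fun y _ ↦ max_le (by linarith [hQ.1 y]) (by linarith [hP.1 y])
      _ = 2 := by rw [Finset.sum_add_distrib, hP.2, hQ.2]; norm_num
  have h3 : ∑ y, min (P y) (Q y) ≤ ∑ y, P y * φ y + ∑ y, Q y * (1 - φ y) := by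
    rw [← Finset.sum_add_distrib]
    refine Finset.sum_le_sum fun y _ ↦ ?_
    have := mul_le_mul_of_nonneg_right (min_le_left (P y) (Q y)) (hφ y).1
    have := mul_le_mul_of_nonneg_right (min_le_right (P y) (Q y)) (sub_nonneg.2 (hφ y).2)
    linarith
  have h4 : 0 ≤ ∑ y, min (P y) (Q y) :=
    Finset.sum_nonneg fun y _ ↦ le_min (hP.1 y) (hQ.1 y)
  calc _ ≤ _ := h1
    _ ≤ (∑ y, min (P y) (Q y)) * 2 := by gcongr
    _ ≤ _ := by linarith

lemma bddAbove_error (h𝒜 : ∀ P ∈ 𝒜, IsDist P) {φ : (Fin n → X) → ℝ} (hφ : ∀ x, φ x ≤ 1) :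
    BddAbove (Set.range fun P : 𝒜 ↦ ∑ x : Fin n → X, (∏ i, (P : X → ℝ) (x i)) * φ x) := by
  refine ⟨1, ?_⟩
  rintro _ ⟨⟨P, hP⟩, rfl⟩
  have h := (h𝒜 P hP).prod n
  refine le_of_le_of_eq (Finset.sum_le_sum fun x _ ↦ ?_) h.2
  exact mul_le_of_le_one_right (h.1 x) (hφ x)

lemma error_add_error_le_errSum (h𝒜 : ∀ P ∈ 𝒜, IsDist P) (hℬ : ∀ Q ∈ ℬ, IsDist Q)
    {φ : (Fin n → X) → ℝ} (hφ : ∀ x, 0 ≤ φ x ∧ φ x ≤ 1) {P Q : X → ℝ} (hP : P ∈ 𝒜)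
    (hQ : Q ∈ ℬ) :
    ∑ x : Fin n → X, (∏ i, P (x i)) * φ x + ∑ x : Fin n → X, (∏ i, Q (x i)) * (1 - φ x) ≤
      errSum 𝒜 ℬ n φ :=
  add_le_add (le_ciSup (bddAbove_error h𝒜 fun x ↦ (hφ x).2) ⟨P, hP⟩)
    (le_ciSup (bddAbove_error (φ := fun x ↦ 1 - φ x) hℬ fun x ↦ by linarith [(hφ x).1]) ⟨Q, hQ⟩)

lemma le_mul_hellSq_of_eStar_le (h𝒜 : ∀ P ∈ 𝒜, IsDist P) (hℬ : ∀ Q ∈ ℬ, IsDist Q)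
    (h : eStar 𝒜 ℬ n ≤ 1 / 10) {P Q : X → ℝ} (hP : P ∈ 𝒜) (hQ : Q ∈ ℬ) :
    4 / 5 ≤ n * hellSq P Q := by
  set ρ := ∑ x, √(P x * Q x) with hρ
  have hρ0 : 0 ≤ ρ := Finset.sum_nonneg fun _ _ ↦ Real.sqrt_nonneg _
  have hprod : ∑ x : Fin n → X, √((∏ i, P (x i)) * ∏ i, Q (x i)) = ρ ^ n := by
    rw [hρ, Fintype.sum_pow]
    refine Finset.sum_congr rfl fun x _ ↦ ?_
    rw [← Finset.prod_mul_distrib, Real.sqrt_prod]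
    exact fun i _ ↦ mul_nonneg ((h𝒜 P hP).1 _) ((hℬ Q hQ).1 _)
  have : Nonempty {φ : (Fin n → X) → ℝ // ∀ x, 0 ≤ φ x ∧ φ x ≤ 1} :=
    ⟨⟨fun _ ↦ 0, fun _ ↦ ⟨le_rfl, zero_le_one⟩⟩⟩
  have h1 : (ρ ^ n) ^ 2 / 2 ≤ eStar 𝒜 ℬ n := le_ciInf fun ⟨φ, hφ⟩ ↦ by
    have := sq_sum_sqrt_mul_le ((h𝒜 P hP).prod n) ((hℬ Q hQ).prod n) hφ
    rw [hprod] at this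
    linarith [error_add_error_le_errSum h𝒜 hℬ hφ hP hQ]
  have h2 := one_add_mul_le_pow (a := ρ - 1) (by linarith) (n * 2)
  rw [add_sub_cancel, pow_mul] at h2
  push_cast at h2
  rw [hellSq_eq (h𝒜 P hP) (hℬ Q hQ)]
  linarith

/-- First-order optimality of a maximizer of the smoothed affinity. -/
lemma sum_mul_sqrt_div_le_of_isMaxOn (h𝒜 : Convex ℝ 𝒜) (h𝒜0 : ∀ P ∈ 𝒜, ∀ x, 0 ≤ P x)
    {P₀ b : X → ℝ} (hP₀ : P₀ ∈ 𝒜) {η : ℝ} (hη : 0 < η) (hb : ∀ x, 0 < b x)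
    (hmax : IsMaxOn (fun P : X → ℝ ↦ ∑ x, √((P x + η) * b x)) 𝒜 P₀) {P : X → ℝ} (hP : P ∈ 𝒜) :
    ∑ x, P x * √(b x / (P₀ x + η)) ≤ ∑ x, √((P₀ x + η) * b x) := by
  have ha : ∀ x, 0 < P₀ x + η := fun x ↦ add_pos_of_nonneg_of_pos (h𝒜0 _ hP₀ x) hη
  set f : ℝ → ℝ := fun t ↦ ∑ x, √((P₀ x + t * (P x - P₀ x) + η) * b x) with hf
  have hder : HasDerivAt f (∑ x, (P x - P₀ x) * b x / (2 * √((P₀ x + η) * b x))) 0 := by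
    refine HasDerivAt.fun_sum fun x _ ↦ ?_
    have h := ((((hasDerivAt_id (0 : ℝ)).mul_const (P x - P₀ x)).const_add
      (P₀ x)).add_const η).mul_const (b x)
    have h' := h.sqrt (by simpa using ⟨(ha x).ne', (hb x).ne'⟩)
    simpa using h'
  have hle : ∑ x, (P x - P₀ x) * b x / (2 * √((P₀ x + η) * b x)) ≤ 0 := by
    refine le_of_tendsto (hder.tendsto_slope_zero_right) ?_
    filter_upwards [Ioc_mem_nhdsGT (zero_lt_one (α := ℝ))] with t ht
    have hmem : P₀ + t • (P - P₀) ∈ 𝒜 := h𝒜.add_smul_sub_mem hP₀ hP ⟨ht.1.le, ht.2⟩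
    have := hmax hmem
    simp only [Set.mem_ofPred_eq, Pi.add_apply, Pi.smul_apply, Pi.sub_apply, smul_eq_mul] at this
    simp only [hf, zero_add, zero_mul, add_zero, smul_eq_mul]
    exact mul_nonpos_of_nonneg_of_nonpos (inv_nonneg.2 ht.1.le) (by linarith)
  have hsqrt : ∀ x, b x / √((P₀ x + η) * b x) = √(b x / (P₀ x + η)) := fun x ↦ by
    rw [Real.sqrt_mul (ha x).le, Real.sqrt_div (hb x).le]
    have := Real.sqrt_pos.2 (ha x)
    have := Real.sqrt_pos.2 (hb x)
    field_simp
    rw [Real.sq_sqrt (hb x).le]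
  have hterm : ∀ x, (P x - P₀ x) * b x / (2 * √((P₀ x + η) * b x)) =
      (P x * √(b x / (P₀ x + η)) - P₀ x * √(b x / (P₀ x + η))) / 2 := fun x ↦ by
    rw [← hsqrt]
    field_simp
  simp only [hterm, ← Finset.sum_div, Finset.sum_sub_distrib] at hle
  have hP₀le : ∑ x, P₀ x * √(b x / (P₀ x + η)) ≤ ∑ x, √((P₀ x + η) * b x) := by
    refine Finset.sum_le_sum fun x _ ↦ ?_
    have hx : (P₀ x + η) * √(b x / (P₀ x + η)) = √((P₀ x + η) * b x) := by
      rw [Real.sqrt_mul (ha x).le, Real.sqrt_div (hb x).le]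
      have := Real.sqrt_pos.2 (ha x)
      field_simp
      rw [Real.sq_sqrt (ha x).le, mul_comm]
    rw [← hx]
    exact mul_le_mul_of_nonneg_right (by linarith) (Real.sqrt_nonneg _)
  linarith

/-- A strictly positive approximate likelihood ratio that separates two compact convex sets. -/
lemma exists_ratio (h𝒜 : Convex ℝ 𝒜) (hℬ : Convex ℝ ℬ) (c𝒜 : IsCompact 𝒜) (cℬ : IsCompact ℬ)
    (ne𝒜 : 𝒜.Nonempty) (neℬ : ℬ.Nonempty) (d𝒜 : ∀ P ∈ 𝒜, IsDist P) (dℬ : ∀ Q ∈ ℬ, IsDist Q)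
    {ρ ρ' : ℝ} (hρ : ∀ P ∈ 𝒜, ∀ Q ∈ ℬ, ∑ x, √(P x * Q x) ≤ ρ) (hρρ' : ρ < ρ') :
    ∃ g : X → ℝ, (∀ x, 0 < g x) ∧ (∀ P ∈ 𝒜, ∑ x, P x * g x ≤ ρ') ∧
      ∀ Q ∈ ℬ, ∑ x, Q x * (g x)⁻¹ ≤ ρ' := by
  obtain ⟨η, hη, hηρ⟩ : ∃ η : ℝ, 0 < η ∧ Fintype.card X * √(2 * η + η ^ 2) < ρ' - ρ := by
    have hc : Filter.Tendsto (fun η : ℝ ↦ Fintype.card X * √(2 * η + η ^ 2))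
        (nhdsWithin 0 (Set.Ioi 0)) (nhds (Fintype.card X * √(2 * 0 + 0 ^ 2))) :=
      Continuous.tendsto (by fun_prop) 0 |>.mono_left nhdsWithin_le_nhds
    have hlt : (Fintype.card X : ℝ) * √(2 * 0 + 0 ^ 2) < ρ' - ρ := by simpa using hρρ'
    obtain ⟨η, h1, h2⟩ := ((hc.eventually_lt_const hlt).and self_mem_nhdsWithin).exists
    exact ⟨η, h2, h1⟩
  have hF : ∀ P ∈ 𝒜, ∀ Q ∈ ℬ, ∑ x, √((P x + η) * (Q x + η)) ≤ ρ' := fun P hP Q hQ ↦ by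
    have hle1 : ∀ {R : X → ℝ}, IsDist R → ∀ x, R x ≤ 1 := fun hR x ↦ by
      rw [← hR.2]
      exact Finset.single_le_sum (fun y _ ↦ hR.1 y) (Finset.mem_univ x)
    calc ∑ x, √((P x + η) * (Q x + η)) ≤ ∑ x, (√(P x * Q x) + √(2 * η + η ^ 2)) := by
          refine Finset.sum_le_sum fun x _ ↦ ?_
          have h1 := mul_nonneg ((d𝒜 P hP).1 x) ((dℬ Q hQ).1 x)
          have h2 : 0 ≤ 2 * η + η ^ 2 := by positivity
          rw [Real.sqrt_le_left (by positivity), add_sq, Real.sq_sqrt h1, Real.sq_sqrt h2]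
          have h3 : 0 ≤ 2 * √(P x * Q x) * √(2 * η + η ^ 2) := by positivity
          nlinarith [hle1 (d𝒜 P hP) x, hle1 (dℬ Q hQ) x]
      _ = ∑ x, √(P x * Q x) + Fintype.card X * √(2 * η + η ^ 2) := by
          simp [Finset.sum_add_distrib]
      _ ≤ ρ' := by linarith [hρ P hP Q hQ]
  obtain ⟨⟨P₀, Q₀⟩, ⟨hP₀, hQ₀⟩, hmax⟩ := (c𝒜.prod cℬ).exists_isMaxOn (ne𝒜.prod neℬ)
    (f := fun R : (X → ℝ) × (X → ℝ) ↦ ∑ x, √((R.1 x + η) * (R.2 x + η))) (by fun_prop)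
  have ha : ∀ x, 0 < P₀ x + η := fun x ↦ add_pos_of_nonneg_of_pos ((d𝒜 _ hP₀).1 x) hη
  have hb : ∀ x, 0 < Q₀ x + η := fun x ↦ add_pos_of_nonneg_of_pos ((dℬ _ hQ₀).1 x) hη
  refine ⟨fun x ↦ √((Q₀ x + η) / (P₀ x + η)),
    fun x ↦ Real.sqrt_pos.2 (div_pos (hb x) (ha x)), fun P hP ↦ ?_, fun Q hQ ↦ ?_⟩
  · refine le_trans (sum_mul_sqrt_div_le_of_isMaxOn h𝒜 (fun P hP ↦ (d𝒜 P hP).1) hP₀ hη hb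
      (fun R hR ↦ ?_) hP) (hF P₀ hP₀ Q₀ hQ₀)
    exact hmax (Set.mk_mem_prod hR hQ₀)
  · simp only [← Real.sqrt_inv, inv_div]
    refine le_trans (sum_mul_sqrt_div_le_of_isMaxOn hℬ (fun Q hQ ↦ (dℬ Q hQ).1) hQ₀ hη ha
      (fun R hR ↦ ?_) hQ) ?_
    · have := hmax (Set.mk_mem_prod hP₀ hR)
      simpa only [Set.mem_ofPred_eq, mul_comm] using this
    · simpa only [mul_comm] using hF P₀ hP₀ Q₀ hQ₀

lemma sum_prod_mul_le_of_le_prod {P g : X → ℝ} (hP : IsDist P) (hg : ∀ x, 0 ≤ g x) {ρ : ℝ}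
    (hρ : ∑ x, P x * g x ≤ ρ) {φ : (Fin n → X) → ℝ} (hφ : ∀ x, φ x ≤ ∏ i, g (x i)) :
    ∑ x : Fin n → X, (∏ i, P (x i)) * φ x ≤ ρ ^ n := by
  calc ∑ x : Fin n → X, (∏ i, P (x i)) * φ x
      ≤ ∑ x : Fin n → X, (∏ i, P (x i)) * ∏ i, g (x i) :=
        Finset.sum_le_sum fun x _ ↦ mul_le_mul_of_nonneg_left (hφ x) ((hP.prod n).1 x)
    _ = (∑ x, P x * g x) ^ n := sum_prod_mul_prod P g n
    _ ≤ ρ ^ n := pow_le_pow_left₀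
        (Finset.sum_nonneg fun x _ ↦ mul_nonneg (hP.1 x) (hg x)) hρ n

/-- The Le Cam–Birgé bound for compact convex hypotheses. -/
lemma eStar_le_two_mul_pow (h𝒜 : Convex ℝ 𝒜) (hℬ : Convex ℝ ℬ) (c𝒜 : IsCompact 𝒜)
    (cℬ : IsCompact ℬ) (ne𝒜 : 𝒜.Nonempty) (neℬ : ℬ.Nonempty) (d𝒜 : ∀ P ∈ 𝒜, IsDist P)
    (dℬ : ∀ Q ∈ ℬ, IsDist Q) {ρ ρ' : ℝ}
    (hρ : ∀ P ∈ 𝒜, ∀ Q ∈ ℬ, ∑ x, √(P x * Q x) ≤ ρ) (hρρ' : ρ < ρ') (n : ℕ) :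
    eStar 𝒜 ℬ n ≤ 2 * ρ' ^ n := by
  obtain ⟨g, hg, hgP, hgQ⟩ := exists_ratio h𝒜 hℬ c𝒜 cℬ ne𝒜 neℬ d𝒜 dℬ hρ hρρ'
  have := ne𝒜.to_subtype
  have := neℬ.to_subtype
  have hpos : ∀ x : Fin n → X, 0 < ∏ i, g (x i) := fun x ↦ Finset.prod_pos fun i _ ↦ hg _
  let φ : (Fin n → X) → ℝ := fun x ↦ if 1 ≤ ∏ i, g (x i) then 1 else 0
  have hφ : ∀ x, 0 ≤ φ x ∧ φ x ≤ 1 := fun x ↦ by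
    simp only [φ]
    split_ifs <;> norm_num
  have hφP : ∀ x, φ x ≤ ∏ i, g (x i) := fun x ↦ by
    simp only [φ]
    split_ifs with h
    · exact h
    · exact (hpos x).le
  have hφQ : ∀ x, 1 - φ x ≤ ∏ i, (g (x i))⁻¹ := fun x ↦ by
    rw [Finset.prod_inv_distrib]
    simp only [φ]
    split_ifs with h
    · rw [sub_self]
      exact (inv_pos.2 (hpos x)).le
    · rw [sub_zero]
      exact (one_le_inv₀ (hpos x)).2 (not_le.1 h).le
  have hbdd : BddBelow (Set.range fun φ : {φ : (Fin n → X) → ℝ // ∀ x, 0 ≤ φ x ∧ φ x ≤ 1} ↦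
      errSum 𝒜 ℬ n φ.1) := by
    obtain ⟨P, hP⟩ := ne𝒜
    obtain ⟨Q, hQ⟩ := neℬ
    refine ⟨0, ?_⟩
    rintro _ ⟨⟨ψ, hψ⟩, rfl⟩
    refine le_trans (add_nonneg ?_ ?_) (error_add_error_le_errSum d𝒜 dℬ hψ hP hQ)
    · exact Finset.sum_nonneg fun x _ ↦ mul_nonneg (((d𝒜 P hP).prod n).1 x) (hψ x).1
    · exact Finset.sum_nonneg fun x _ ↦
        mul_nonneg (((dℬ Q hQ).prod n).1 x) (sub_nonneg.2 (hψ x).2)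
  refine (ciInf_le hbdd ⟨φ, hφ⟩).trans ?_
  rw [two_mul]
  refine add_le_add (ciSup_le fun P ↦ ?_) (ciSup_le fun Q ↦ ?_)
  · exact sum_prod_mul_le_of_le_prod (d𝒜 P P.2) (fun x ↦ (hg x).le) (hgP P P.2) hφP
  · exact sum_prod_mul_le_of_le_prod (dℬ Q Q.2) (fun x ↦ (inv_pos.2 (hg x)).le) (hgQ Q Q.2) hφQ

lemma eStar_le_of_le_mul_hellSq (h𝒜 : Convex ℝ 𝒜) (hℬ : Convex ℝ ℬ) (c𝒜 : IsCompact 𝒜)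
    (cℬ : IsCompact ℬ) (ne𝒜 : 𝒜.Nonempty) (neℬ : ℬ.Nonempty) (d𝒜 : ∀ P ∈ 𝒜, IsDist P)
    (dℬ : ∀ Q ∈ ℬ, IsDist Q) {h : ℝ} (h0 : 0 < h) (hh : ∀ P ∈ 𝒜, ∀ Q ∈ ℬ, h ≤ hellSq P Q)
    (hn : 16 ≤ n * h) : eStar 𝒜 ℬ n ≤ 1 / 10 := by
  have hρ : ∀ P ∈ 𝒜, ∀ Q ∈ ℬ, ∑ x, √(P x * Q x) ≤ 1 - h / 2 := fun P hP Q hQ ↦ by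
    have := hh P hP Q hQ
    rw [hellSq_eq (d𝒜 P hP) (dℬ Q hQ)] at this
    linarith
  have hρ' : 1 - h / 2 < Real.exp (-(h / 4)) := by
    linarith [Real.add_one_le_exp (-(h / 4))]
  refine (eStar_le_two_mul_pow h𝒜 hℬ c𝒜 cℬ ne𝒜 neℬ d𝒜 dℬ hρ hρ' n).trans ?_
  rw [← Real.exp_nat_mul]
  have h4 : Real.exp (n * -(h / 4)) ≤ Real.exp (-4) := Real.exp_le_exp.2 (by linarith)
  have h5 : (20 : ℝ) ≤ Real.exp 4 := by
    have h1 := Real.exp_one_gt_d9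
    have h2 : Real.exp 4 = Real.exp 1 ^ 4 := by rw [← Real.exp_nat_mul]; norm_num
    rw [h2]
    calc (20 : ℝ) ≤ 2.7 ^ 4 := by norm_num
      _ ≤ _ := pow_le_pow_left₀ (by norm_num) (by linarith) 4
  have h6 : Real.exp (-4) ≤ 1 / 20 := by
    rw [Real.exp_neg, ← one_div]
    exact one_div_le_one_div_of_le (by norm_num) h5
  linarith

/-- Comparing minimal Hellinger divergences of convex hypotheses compares sample complexities. -/
lemma nStar_le_mul_nStar {𝒜' ℬ' : Set (X → ℝ)} (h𝒜 : Convex ℝ 𝒜) (hℬ : Convex ℝ ℬ)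
    (c𝒜 : IsCompact 𝒜) (cℬ : IsCompact ℬ) (ne𝒜 : 𝒜.Nonempty) (neℬ : ℬ.Nonempty)
    (d𝒜 : ∀ P ∈ 𝒜, IsDist P) (dℬ : ∀ Q ∈ ℬ, IsDist Q) (d𝒜' : ∀ P ∈ 𝒜', IsDist P)
    (dℬ' : ∀ Q ∈ ℬ', IsDist Q) {K : ℝ} (hK : 0 < K)
    (h : ∀ P ∈ 𝒜, ∀ Q ∈ ℬ, ∃ P' ∈ 𝒜', ∃ Q' ∈ ℬ', hellSq P' Q' ≤ K * hellSq P Q) :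
    nStar 𝒜 ℬ ≤ ENNReal.ofReal (20 * K + 1) * nStar 𝒜' ℬ' := by
  have hC : 0 < 20 * K + 1 := by positivity
  rw [mul_comm, ← ENNReal.div_le_iff (ENNReal.ofReal_pos.2 hC).ne' ENNReal.ofReal_ne_top]
  refine le_sInf ?_
  rintro _ ⟨n, rfl, hn⟩
  rw [ENNReal.div_le_iff (ENNReal.ofReal_pos.2 hC).ne' ENNReal.ofReal_ne_top]
  have hell : ∀ P ∈ 𝒜, ∀ Q ∈ ℬ, 4 / 5 ≤ n * (K * hellSq P Q) := fun P hP Q hQ ↦ by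
    obtain ⟨P', hP', Q', hQ', hle⟩ := h P hP Q hQ
    exact (le_mul_hellSq_of_eStar_le d𝒜' dℬ' hn hP' hQ').trans (by gcongr)
  have hn1 : 1 ≤ n := by
    obtain ⟨P, hP⟩ := ne𝒜
    obtain ⟨Q, hQ⟩ := neℬ
    rw [Nat.one_le_iff_ne_zero]
    rintro rfl
    have := hell P hP Q hQ
    norm_num at this
  have hn0 : (0 : ℝ) < n := by exact_mod_cast hn1
  have hm : eStar 𝒜 ℬ ⌈20 * K * n⌉₊ ≤ 1 / 10 := by
    refine eStar_le_of_le_mul_hellSq h𝒜 hℬ c𝒜 cℬ ne𝒜 neℬ d𝒜 dℬ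
      (h := 4 / 5 / (n * K)) (by positivity) (fun P hP Q hQ ↦ ?_) ?_
    · rw [div_le_iff₀ (by positivity)]
      linarith [hell P hP Q hQ]
    · calc (16 : ℝ) = 20 * K * n * (4 / 5 / (n * K)) := by field_simp; norm_num
        _ ≤ _ := by
          gcongr
          exact Nat.le_ceil _
  calc nStar 𝒜 ℬ ≤ (⌈20 * K * n⌉₊ : ℝ≥0∞) := sInf_le ⟨_, rfl, hm⟩
    _ = ENNReal.ofReal ⌈20 * K * n⌉₊ := (ENNReal.ofReal_natCast _).symm
    _ ≤ ENNReal.ofReal (n * (20 * K + 1)) := by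
        refine ENNReal.ofReal_le_ofReal ?_
        have h1 := (Nat.ceil_lt_add_one (by positivity : 0 ≤ 20 * K * n)).le
        have h2 : (1 : ℝ) ≤ n := by exact_mod_cast hn1
        linarith
    _ = n * ENNReal.ofReal (20 * K + 1) := by
        rw [ENNReal.ofReal_mul hn0.le, ENNReal.ofReal_natCast]

end Testing

/-- Sandwich bounds between the subtractive and Huber sample complexities:
`n*_Sub(ε) ≲ n*_Hub(ε) ≲ n*_Sub((1+δ₀)ε)`. -/
theorem hub_sub_sandwich :
    (∃ C : ℝ, 0 < C ∧
      ∀ (X : Type) [Fintype X] [Nonempty X] (p q : X → ℝ),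
        IsDist p → IsDist q →
        ∀ ε : ℝ, 0 < ε → ε ≤ dTV p q / 4 →
          nStar (PSub p ε) (PSub q ε) ≤
            ENNReal.ofReal C * nStar (PHub p ε) (PHub q ε)) ∧
    (∀ δ₀ : ℝ, 0 < δ₀ →
      ∃ C' εbar : ℝ, 0 < C' ∧ 0 < εbar ∧
        ∀ (X : Type) [Fintype X] [Nonempty X] (p q : X → ℝ),
          IsDist p → IsDist q →
          ∀ ε : ℝ, 0 < ε → ε ≤ dTV p q / 4 → ε ≤ εbar → (1 + δ₀) * ε < 1 →
            nStar (PHub p ε) (PHub q ε) ≤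
              ENNReal.ofReal C' *
                nStar (PSub p ((1 + δ₀) * ε)) (PSub q ((1 + δ₀) * ε))) := by
  refine ⟨⟨20 * 2 + 1, by norm_num, fun X _ _ p q hp hq ε h0 hε ↦ ?_⟩, fun δ₀ hδ₀ ↦ ?_⟩
  · have hε1 : ε < 1 := by linarith [dTV_le_one hp hq]
    exact nStar_le_mul_nStar convex_PSub convex_PSub isCompact_PSub isCompact_PSub
      ⟨p, self_mem_PSub hp h0.le⟩ ⟨q, self_mem_PSub hq h0.le⟩ (fun _ h ↦ h.1) (fun _ h ↦ h.1)
      (fun _ h ↦ h.1) (fun _ h ↦ h.1) two_pos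
      fun P hP Q hQ ↦ exists_PHub_hellSq_le hp hq h0.le hε1 hP hQ
  · set δ := min δ₀ 1
    have hδ0 : 0 < δ := lt_min hδ₀ one_pos
    refine ⟨20 * (32 / δ) + 1, δ / 10, by positivity, by positivity,
      fun X _ _ p q hp hq ε h0 hε hεδ _ ↦ ?_⟩
    refine nStar_le_mul_nStar convex_PHub convex_PHub isCompact_PHub isCompact_PHub
      ⟨p, self_mem_PHub hp h0.le⟩ ⟨q, self_mem_PHub hq h0.le⟩ (fun _ h ↦ h.1) (fun _ h ↦ h.1)
      (fun _ h ↦ h.1) (fun _ h ↦ h.1) (by positivity) fun P hP Q hQ ↦ ?_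
    obtain ⟨P', hP', Q', hQ', h⟩ :=
      exists_PSub_hellSq_le hp hq h0.le hδ0 (min_le_right _ _) hε hεδ hP hQ
    have hle : (1 + δ) * ε ≤ (1 + δ₀) * ε := by
      gcongr
      exact min_le_left _ _
    exact ⟨P', PSub_mono hp hle hP', Q', PSub_mono hq hle hQ', h⟩

end
end

section
/- (a) For every nonempty finite set X, every distribution p on X, and every ε ∈ [0,1): 𝒫_Hub(p,ε) ⊆ 𝒫_TV(p,ε) and 𝒫_Sub(p,ε) ⊆ 𝒫_TV(p,ε). (b) For every C > 0 there exist a finite set X, a distribution p on X, and ε ∈ (0,1) with Cε < 1 such that 𝒫_TV(p,ε) is not contained in 𝒫_Hub(p,Cε); and for every C > 0 there exist X, p, ε such that 𝒫_TV(p,ε) is not contained in 𝒫_Sub(p,Cε). (c) For every c > 0 there exist a finite set X, a distribution p on X, and ε ∈ (0,1) such that 𝒫_Hub(p,cε) is not contained in 𝒫_Sub(p,ε); and for every C > 0 there exist X, p, and ε ∈ (0,1) with Cε < 1 such that 𝒫_Sub(p,ε) is not contained in 𝒫_Hub(p,Cε). -/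
open scoped Classical
open Finset

noncomputable section

/-- The distribution on two points with mass `t` on the second one. -/
def twoPoint (t : ℝ) : Fin (1 + 1) → ℝ := ![1 - t, t]

theorem isDist_twoPoint {t : ℝ} (h0 : 0 ≤ t) (h1 : t ≤ 1) : IsDist (twoPoint t) := by
  refine ⟨fun x => ?_, by simp [twoPoint, Fin.sum_univ_two]⟩
  fin_cases x <;> simp [twoPoint, h0, h1]

theorem dTV_twoPoint (s t : ℝ) : dTV (twoPoint s) (twoPoint t) = |s - t| := by
  have h : |1 - s - (1 - t)| = |s - t| := by rw [abs_sub_comm s t]; congr 1; ring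
  simp only [dTV, twoPoint, Nat.reduceAdd, Fin.sum_univ_two, Matrix.cons_val_zero, Matrix.cons_val_one, h]
  ring

theorem twoPoint_mem_PHub_iff {s t ε : ℝ} (h0 : 0 ≤ s) (h1 : s ≤ 1) :
    twoPoint s ∈ PHub (twoPoint t) ε ↔ (1 - ε) * (1 - t) ≤ 1 - s ∧ (1 - ε) * t ≤ s := by
  simp only [PHub, Set.mem_ofPred_eq, isDist_twoPoint h0 h1, true_and]
  simp [Fin.forall_fin_two, twoPoint]

theorem twoPoint_mem_PTV_iff {s t ε : ℝ} (h0 : 0 ≤ s) (h1 : s ≤ 1) :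
    twoPoint s ∈ PTV (twoPoint t) ε ↔ |s - t| ≤ ε := by
  simp [PTV, isDist_twoPoint h0 h1, dTV_twoPoint]

theorem twoPoint_mem_PSub_iff {s t ε : ℝ} (h0 : 0 ≤ s) (h1 : s ≤ 1) :
    twoPoint s ∈ PSub (twoPoint t) ε ↔ 1 - s ≤ (1 + ε) * (1 - t) ∧ s ≤ (1 + ε) * t := by
  simp only [PSub, Set.mem_ofPred_eq, isDist_twoPoint h0 h1, true_and]
  simp [Fin.forall_fin_two, twoPoint]

theorem PHub_subset_PTV {X : Type*} [Fintype X] {p : X → ℝ} (hp : IsDist p) {ε : ℝ}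
    (hε : 0 ≤ ε) : PHub p ε ⊆ PTV p ε := by
  rintro q ⟨hq, h⟩
  refine ⟨hq, ?_⟩
  have key : ∑ x, |q x - p x| ≤ ∑ x, (q x - p x + 2 * ε * p x) := by
    refine Finset.sum_le_sum fun x _ => abs_le.2 ⟨?_, ?_⟩
    · linarith [h x]
    · linarith [mul_nonneg hε (hp.1 x)]
  rw [Finset.sum_add_distrib, Finset.sum_sub_distrib, ← Finset.mul_sum, hq.2, hp.2] at key
  unfold dTV
  linarith

theorem PSub_subset_PTV {X : Type*} [Fintype X] {p : X → ℝ} (hp : IsDist p) {ε : ℝ}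
    (hε : 0 ≤ ε) : PSub p ε ⊆ PTV p ε := by
  rintro q ⟨hq, h⟩
  refine ⟨hq, ?_⟩
  have key : ∑ x, |q x - p x| ≤ ∑ x, (p x - q x + 2 * ε * p x) := by
    refine Finset.sum_le_sum fun x _ => abs_le.2 ⟨?_, ?_⟩
    · linarith [mul_nonneg hε (hp.1 x)]
    · linarith [h x]
  rw [Finset.sum_add_distrib, Finset.sum_sub_distrib, ← Finset.mul_sum, hq.2, hp.2] at key
  unfold dTV
  linarith

theorem exists_pos_lt_one_mul_lt_one {C : ℝ} (hC : 0 < C) :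
    ∃ ε : ℝ, 0 < ε ∧ ε < 1 ∧ C * ε < 1 := by
  refine ⟨1 / (C + 1), by positivity, ?_, ?_⟩
  · rw [div_lt_one (by positivity)]; linarith
  · rw [mul_one_div, div_lt_one (by positivity)]; linarith

/-- No-simulation lemma: the Huber and subtractive uncertainty sets are contained in the TV
uncertainty set at the same level, but no other containment holds in general, no matter the
constant rescaling of ε. (Nonempty finite sets are represented as `Fin (n+1)`.) -/
theorem containment_and_no_simulation :
    -- (a) containments
    (∀ (X : Type) [Fintype X] (p : X → ℝ), IsDist p → ∀ ε : ℝ, 0 ≤ ε → ε < 1 →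
      PHub p ε ⊆ PTV p ε ∧ PSub p ε ⊆ PTV p ε) ∧
    -- (b) TV is not simulated by Huber or subtractive
    (∀ C : ℝ, 0 < C → ∃ (n : ℕ) (p : Fin (n + 1) → ℝ) (ε : ℝ),
      IsDist p ∧ 0 < ε ∧ ε < 1 ∧ C * ε < 1 ∧ ¬ PTV p ε ⊆ PHub p (C * ε)) ∧
    (∀ C : ℝ, 0 < C → ∃ (n : ℕ) (p : Fin (n + 1) → ℝ) (ε : ℝ),
      IsDist p ∧ 0 < ε ∧ ε < 1 ∧ ¬ PTV p ε ⊆ PSub p (C * ε)) ∧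
    -- (c) Huber and subtractive do not simulate each other
    (∀ c : ℝ, 0 < c → ∃ (n : ℕ) (p : Fin (n + 1) → ℝ) (ε : ℝ),
      IsDist p ∧ 0 < ε ∧ ε < 1 ∧ ¬ PHub p (c * ε) ⊆ PSub p ε) ∧
    (∀ C : ℝ, 0 < C → ∃ (n : ℕ) (p : Fin (n + 1) → ℝ) (ε : ℝ),
      IsDist p ∧ 0 < ε ∧ ε < 1 ∧ C * ε < 1 ∧ ¬ PSub p ε ⊆ PHub p (C * ε)) := by
  refine ⟨fun X _ p hp ε h0 _ => ⟨PHub_subset_PTV hp h0, PSub_subset_PTV hp h0⟩,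
    fun C hC => ?_, fun C hC => ?_, fun c hc => ?_, fun C hC => ?_⟩
  · obtain ⟨ε, h0, h1, h2⟩ := exists_pos_lt_one_mul_lt_one hC
    refine ⟨1, twoPoint ε, ε, isDist_twoPoint h0.le h1.le, h0, h1, h2, fun h => ?_⟩
    have hm : twoPoint 0 ∈ PTV (twoPoint ε) ε :=
      (twoPoint_mem_PTV_iff le_rfl zero_le_one).2 (by simp [abs_of_pos h0])
    have hH := ((twoPoint_mem_PHub_iff le_rfl zero_le_one).1 (h hm)).2
    exact absurd hH (not_le.2 (mul_pos (sub_pos.2 h2) h0))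
  · refine ⟨1, twoPoint 0, 1 / 2, isDist_twoPoint le_rfl zero_le_one, by norm_num, by norm_num,
      fun h => ?_⟩
    have hm : twoPoint (1 / 2) ∈ PTV (twoPoint 0) (1 / 2) :=
      (twoPoint_mem_PTV_iff (by norm_num) (by norm_num)).2 (by norm_num [abs_of_pos])
    have hS := ((twoPoint_mem_PSub_iff (by norm_num) (by norm_num)).1 (h hm)).2
    norm_num at hS
  · obtain ⟨ε, h0, h1, h2⟩ := exists_pos_lt_one_mul_lt_one hc
    have hpos := mul_pos hc h0
    refine ⟨1, twoPoint 0, ε, isDist_twoPoint le_rfl zero_le_one, h0, h1, fun h => ?_⟩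
    have hm : twoPoint (c * ε) ∈ PHub (twoPoint 0) (c * ε) :=
      (twoPoint_mem_PHub_iff hpos.le h2.le).2 ⟨by simp, by simpa using hpos.le⟩
    have hS := ((twoPoint_mem_PSub_iff hpos.le h2.le).1 (h hm)).2
    linarith
  · obtain ⟨ε, h0, h1, h2⟩ := exists_pos_lt_one_mul_lt_one hC
    refine ⟨1, twoPoint (ε / 2), ε, isDist_twoPoint (by linarith) (by linarith), h0, h1, h2,
      fun h => ?_⟩
    have hm : twoPoint 0 ∈ PSub (twoPoint (ε / 2)) ε :=
      (twoPoint_mem_PSub_iff le_rfl zero_le_one).2 ⟨by nlinarith, by positivity⟩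
    have hH := ((twoPoint_mem_PHub_iff le_rfl zero_le_one).1 (h hm)).2
    exact absurd hH (not_le.2 (mul_pos (sub_pos.2 h2) (half_pos h0)))

end
end
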